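/- For every integer n ≥ 1, the following identity holds in ℤ[p,q,t,u,v,w]: Σ_{σ∈S_n} p^{res σ} q^{les σ} t^{des σ} u^{da* σ} v^{dd* σ} w^{valley* σ} = Σ_{γ∈M_{n−1}} (tw)^{NE(γ)} (u+tv)^{E(γ)} Π_{s step of γ} [h(s)+1]_{p,q}, where M_{n−1} is the set of Motzkin paths of length n−1, NE(γ) and E(γ) are the numbers of up steps and level steps of γ, h(s) is the height (ordinate of the starting point) of the step s, and [m]_{p,q} = p^{m−1} + p^{m−2}q + ⋯ + q^{m−1} is the (p,q)-integer. -/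

import Mathlib

open scoped Classical
open Finset

noncomputable section

namespace SZpaper

/-- `σ` as a 1-indexed function on `[1,n]`, extended by `0` elsewhere
(boundary convention `σ(0)=σ(n+1)=0`). -/
def pext (n : ℕ) (σ : Equiv.Perm (Fin n)) (i : ℕ) : ℕ :=
  if h : 1 ≤ i ∧ i ≤ n then ((σ ⟨i - 1, by omega⟩ : Fin n) : ℕ) + 1 else 0

/-- `σ` extended with the Brändén boundary convention `σ(0)=σ(n+1)=n+1`. -/
def pextB (n : ℕ) (σ : Equiv.Perm (Fin n)) (i : ℕ) : ℕ :=
  if h : 1 ≤ i ∧ i ≤ n then ((σ ⟨i - 1, by omega⟩ : Fin n) : ℕ) + 1 else n + 1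

/-- `σ` extended with the boundary convention `σ(0)=0`, `σ(n+1)=n+1`. -/
def pextC (n : ℕ) (σ : Equiv.Perm (Fin n)) (i : ℕ) : ℕ :=
  if h : 1 ≤ i ∧ i ≤ n then ((σ ⟨i - 1, by omega⟩ : Fin n) : ℕ) + 1
  else if i = 0 then 0 else n + 1

/-- The set of pairs `(i,j)` with `i, j ∈ [1,n]`. -/
def pairs (n : ℕ) : Finset (ℕ × ℕ) := Finset.Icc 1 n ×ˢ Finset.Icc 1 n

/-- `des σ = #{i ∈ [n−1] : σ(i) > σ(i+1)}`. -/
def desStat (n : ℕ) (σ : Equiv.Perm (Fin n)) : ℕ :=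
  ((Finset.Icc 1 (n - 1)).filter fun i => pext n σ (i + 1) < pext n σ i).card

/-- `les σ = #{(i,j) : 2 ≤ i < j ≤ n, σ(i−1) > σ(j) > σ(i)}`. -/
def lesStat (n : ℕ) (σ : Equiv.Perm (Fin n)) : ℕ :=
  ((pairs n).filter fun x => 2 ≤ x.1 ∧ x.1 < x.2 ∧
    pext n σ x.1 < pext n σ x.2 ∧ pext n σ x.2 < pext n σ (x.1 - 1)).card

/-- `less σ = #{(i,j) : 2 ≤ i < j ≤ n, σ(i−1) < σ(j) < σ(i)}`. -/
def lessStat (n : ℕ) (σ : Equiv.Perm (Fin n)) : ℕ :=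
  ((pairs n).filter fun x => 2 ≤ x.1 ∧ x.1 < x.2 ∧
    pext n σ (x.1 - 1) < pext n σ x.2 ∧ pext n σ x.2 < pext n σ x.1).card

/-- `res σ = #{(i,j) : 1 ≤ i < j ≤ n−1, σ(j+1) > σ(i) > σ(j)}`. -/
def resStat (n : ℕ) (σ : Equiv.Perm (Fin n)) : ℕ :=
  ((pairs n).filter fun x => x.1 < x.2 ∧ x.2 ≤ n - 1 ∧
    pext n σ x.2 < pext n σ x.1 ∧ pext n σ x.1 < pext n σ (x.2 + 1)).card

/-- `ress σ = #{(i,j) : 1 ≤ i < j ≤ n−1, σ(j+1) < σ(i) < σ(j)}`. -/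
def ressStat (n : ℕ) (σ : Equiv.Perm (Fin n)) : ℕ :=
  ((pairs n).filter fun x => x.1 < x.2 ∧ x.2 ≤ n - 1 ∧
    pext n σ (x.2 + 1) < pext n σ x.1 ∧ pext n σ x.1 < pext n σ x.2).card

/-! Linear statistics with the boundary convention `σ(0)=σ(n+1)=0` (starred). -/

def peakStar (n : ℕ) (σ : Equiv.Perm (Fin n)) : ℕ :=
  ((Finset.Icc 1 n).filter fun i =>
    pext n σ (i - 1) < pext n σ i ∧ pext n σ (i + 1) < pext n σ i).card

def valleyStar (n : ℕ) (σ : Equiv.Perm (Fin n)) : ℕ :=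
  ((Finset.Icc 1 n).filter fun i =>
    pext n σ i < pext n σ (i - 1) ∧ pext n σ i < pext n σ (i + 1)).card

def daStar (n : ℕ) (σ : Equiv.Perm (Fin n)) : ℕ :=
  ((Finset.Icc 1 n).filter fun i =>
    pext n σ (i - 1) < pext n σ i ∧ pext n σ i < pext n σ (i + 1)).card

def ddStar (n : ℕ) (σ : Equiv.Perm (Fin n)) : ℕ :=
  ((Finset.Icc 1 n).filter fun i =>
    pext n σ (i + 1) < pext n σ i ∧ pext n σ i < pext n σ (i - 1)).card

/-! Linear statistics with the Brändén boundary convention `σ(0)=σ(n+1)=n+1`. -/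

def peakB (n : ℕ) (σ : Equiv.Perm (Fin n)) : ℕ :=
  ((Finset.Icc 1 n).filter fun i =>
    pextB n σ (i - 1) < pextB n σ i ∧ pextB n σ (i + 1) < pextB n σ i).card

def valleyB (n : ℕ) (σ : Equiv.Perm (Fin n)) : ℕ :=
  ((Finset.Icc 1 n).filter fun i =>
    pextB n σ i < pextB n σ (i - 1) ∧ pextB n σ i < pextB n σ (i + 1)).card

def daB (n : ℕ) (σ : Equiv.Perm (Fin n)) : ℕ :=
  ((Finset.Icc 1 n).filter fun i =>
    pextB n σ (i - 1) < pextB n σ i ∧ pextB n σ i < pextB n σ (i + 1)).card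

def ddB (n : ℕ) (σ : Equiv.Perm (Fin n)) : ℕ :=
  ((Finset.Icc 1 n).filter fun i =>
    pextB n σ (i + 1) < pextB n σ i ∧ pextB n σ i < pextB n σ (i - 1)).card

/-! Linear statistics with the boundary convention `σ(0)=0`, `σ(n+1)=n+1`. -/

def valleyC (n : ℕ) (σ : Equiv.Perm (Fin n)) : ℕ :=
  ((Finset.Icc 1 n).filter fun i =>
    pextC n σ i < pextC n σ (i - 1) ∧ pextC n σ i < pextC n σ (i + 1)).card

def daC (n : ℕ) (σ : Equiv.Perm (Fin n)) : ℕ :=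
  ((Finset.Icc 1 n).filter fun i =>
    pextC n σ (i - 1) < pextC n σ i ∧ pextC n σ i < pextC n σ (i + 1)).card

def ddC (n : ℕ) (σ : Equiv.Perm (Fin n)) : ℕ :=
  ((Finset.Icc 1 n).filter fun i =>
    pextC n σ (i + 1) < pextC n σ i ∧ pextC n σ i < pextC n σ (i - 1)).card

/-- `fmax σ`: the number of double ascents (convention `σ(0)=0`, `σ(n+1)=n+1`)
which are left-to-right maxima. -/
def fmaxStat (n : ℕ) (σ : Equiv.Perm (Fin n)) : ℕ :=
  ((Finset.Icc 1 n).filter fun i =>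
    pextC n σ (i - 1) < pextC n σ i ∧ pextC n σ i < pextC n σ (i + 1) ∧
    ∀ j ∈ Finset.Ico 1 i, pext n σ j < pext n σ i).card

/-! Cyclic statistics. -/

def excStat (n : ℕ) (σ : Equiv.Perm (Fin n)) : ℕ :=
  ((Finset.Icc 1 n).filter fun i => i < pext n σ i).card

def wexStat (n : ℕ) (σ : Equiv.Perm (Fin n)) : ℕ :=
  ((Finset.Icc 1 n).filter fun i => i ≤ pext n σ i).card

def dropStat (n : ℕ) (σ : Equiv.Perm (Fin n)) : ℕ :=
  ((Finset.Icc 1 n).filter fun i => pext n σ i < i).card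

def fixStat (n : ℕ) (σ : Equiv.Perm (Fin n)) : ℕ :=
  ((Finset.Icc 1 n).filter fun i => pext n σ i = i).card

/-- cyclic valleys: `x` with `σ⁻¹(x) > x < σ(x)`. -/
def cvalleyStat (n : ℕ) (σ : Equiv.Perm (Fin n)) : ℕ :=
  ((Finset.Icc 1 n).filter fun x => x < pext n σ⁻¹ x ∧ x < pext n σ x).card

/-- double excedances: `x` with `σ⁻¹(x) < x < σ(x)`. -/
def cdaStat (n : ℕ) (σ : Equiv.Perm (Fin n)) : ℕ :=
  ((Finset.Icc 1 n).filter fun x => pext n σ⁻¹ x < x ∧ x < pext n σ x).card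

/-- double drops: `x` with `σ⁻¹(x) > x > σ(x)`. -/
def cddStat (n : ℕ) (σ : Equiv.Perm (Fin n)) : ℕ :=
  ((Finset.Icc 1 n).filter fun x => x < pext n σ⁻¹ x ∧ pext n σ x < x).card

/-- crossings. -/
def crosStat (n : ℕ) (σ : Equiv.Perm (Fin n)) : ℕ :=
  ((pairs n).filter fun x =>
    (x.1 < x.2 ∧ x.2 ≤ pext n σ x.1 ∧ pext n σ x.1 < pext n σ x.2) ∨
    (x.2 < x.1 ∧ pext n σ x.1 < x.2 ∧ pext n σ x.2 < pext n σ x.1)).card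

/-- nestings. -/
def nestStat (n : ℕ) (σ : Equiv.Perm (Fin n)) : ℕ :=
  ((pairs n).filter fun x =>
    (x.1 < x.2 ∧ x.2 ≤ pext n σ x.2 ∧ pext n σ x.2 < pext n σ x.1) ∨
    (x.2 < x.1 ∧ pext n σ x.2 < x.2 ∧ pext n σ x.1 < pext n σ x.2)).card

/-- number of cycles of `σ` (fixed points count as cycles). -/
def cycStat (n : ℕ) (σ : Equiv.Perm (Fin n)) : ℕ :=
  Multiset.card σ.cycleType + (Finset.univ.filter fun x => σ x = x).card

/-! Star statistics: `σ*(i) = σ(i) − 1`, a bijection `[n] → {0,…,n−1}`;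
we extend `σ*` by `0` outside `[1,n]`. -/

def starf (n : ℕ) (σ : Equiv.Perm (Fin n)) (i : ℕ) : ℕ :=
  if 1 ≤ i ∧ i ≤ n then pext n σ i - 1 else 0

/-- `(σ*)⁻¹(i) = σ⁻¹(i+1)`, defined for `0 ≤ i ≤ n−1`. -/
def invstarf (n : ℕ) (σ : Equiv.Perm (Fin n)) (i : ℕ) : ℕ :=
  pext n σ⁻¹ (i + 1)

def dropStarStat (n : ℕ) (σ : Equiv.Perm (Fin n)) : ℕ :=
  ((Finset.Icc 1 n).filter fun i => starf n σ i < i).card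

def fixStarStat (n : ℕ) (σ : Equiv.Perm (Fin n)) : ℕ :=
  ((Finset.Icc 1 n).filter fun i => starf n σ i = i).card

def wexStarStat (n : ℕ) (σ : Equiv.Perm (Fin n)) : ℕ :=
  ((Finset.Icc 1 n).filter fun i => i ≤ starf n σ i).card

def cdaStarStat (n : ℕ) (σ : Equiv.Perm (Fin n)) : ℕ :=
  ((Finset.Icc 1 n).filter fun i => invstarf n σ i < i ∧ i < starf n σ i).card

def cddStarStat (n : ℕ) (σ : Equiv.Perm (Fin n)) : ℕ :=
  ((Finset.Icc 1 n).filter fun i => i < invstarf n σ i ∧ starf n σ i < i).card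

def cvalleyStarStat (n : ℕ) (σ : Equiv.Perm (Fin n)) : ℕ :=
  ((Finset.Icc 1 n).filter fun i => i < invstarf n σ i ∧ i < starf n σ i).card

def crosStarStat (n : ℕ) (σ : Equiv.Perm (Fin n)) : ℕ :=
  ((pairs n).filter fun x =>
    (x.1 < x.2 ∧ x.2 ≤ starf n σ x.1 ∧ starf n σ x.1 < starf n σ x.2) ∨
    (x.2 < x.1 ∧ starf n σ x.1 < x.2 ∧ starf n σ x.2 < starf n σ x.1)).card

def nestStarStat (n : ℕ) (σ : Equiv.Perm (Fin n)) : ℕ :=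
  ((pairs n).filter fun x =>
    (x.1 < x.2 ∧ x.2 ≤ starf n σ x.2 ∧ starf n σ x.2 < starf n σ x.1) ∨
    (x.2 < x.1 ∧ starf n σ x.2 < x.2 ∧ starf n σ x.1 < starf n σ x.2)).card

/-- `cyc* σ`: the number of cycles of the functional digraph of `σ*` on `[n]`,
counted as the number of `i ∈ [1,n]` that lie on a cycle of `σ*` and are
minimal in their cycle. (The component of `σ*` that is a path from `n` to `0`
contributes no such `i`.) -/
def cycStarStat (n : ℕ) (σ : Equiv.Perm (Fin n)) : ℕ :=
  ((Finset.Icc 1 n).filter fun i =>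
    (∃ m ∈ Finset.Icc 1 n, (starf n σ)^[m] i = i) ∧
    ∀ m ∈ Finset.range (n + 1), i ≤ (starf n σ)^[m] i).card

/-! Motzkin paths, encoded as step sequences `γ : Fin m → Fin 3`
(`0` = up step `(1,1)`, `1` = level step `(1,0)`, `2` = down step `(1,−1)`). -/

/-- The height (ordinate) of the path after `i` steps. -/
def hgt (m : ℕ) (γ : Fin m → Fin 3) (i : ℕ) : ℤ :=
  ∑ j ∈ Finset.range i, if hj : j < m then 1 - ((γ ⟨j, hj⟩ : ℕ) : ℤ) else 0

/-- A step sequence is a Motzkin path if it never goes below the x-axis and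
ends at height `0`. -/
def IsMotzkin (m : ℕ) (γ : Fin m → Fin 3) : Prop :=
  (∀ i ≤ m, 0 ≤ hgt m γ i) ∧ hgt m γ m = 0

/-- The (finite) set of Motzkin paths of length `m`. -/
def motzkin (m : ℕ) : Finset (Fin m → Fin 3) :=
  Finset.univ.filter fun γ => IsMotzkin m γ

/-- number of up (North-East) steps. -/
def neCount (m : ℕ) (γ : Fin m → Fin 3) : ℕ :=
  (Finset.univ.filter fun i => γ i = 0).card

/-- number of level (East) steps. -/
def eCount (m : ℕ) (γ : Fin m → Fin 3) : ℕ :=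
  (Finset.univ.filter fun i => γ i = 1).card

/-- the `(p,q)`-integer `[m]_{p,q} = p^{m−1} + p^{m−2}q + ⋯ + q^{m−1}`. -/
def pqInt {R : Type*} [CommRing R] (p q : R) (m : ℕ) : R :=
  ∑ j ∈ Finset.range m, p ^ (m - 1 - j) * q ^ j

/-! ### Weights of words -/

/-- The number of factors `ab` of the word with `a < x < b`. -/
def ascCount (x : ℕ) : List ℕ → ℕ
  | [] => 0
  | a :: l => (if a < x ∧ x < l.headD 0 then 1 else 0) + ascCount x l

/-- The weight of the letter `x` with the (reversed) word `A` on its left and the word `B` on its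
right; the letter `0` is a separator. -/
def letterWt {R : Type*} [CommRing R] (e : Fin 6 → R) (A : List ℕ) (x : ℕ) (B : List ℕ) : R :=
  if x = 0 then 1 else
    e 0 ^ ascCount x B * e 1 ^ ascCount x A *
      (if x < A.headD 0 then (if x < B.headD 0 then e 2 * e 5 else e 2 * e 4)
        else if x < B.headD 0 then e 3 else 1)

/-- The product of the weights of the letters of `U`, with the (reversed) word `A` on the left of
`U` and the word `B` on its right. -/
def wordWt {R : Type*} [CommRing R] (e : Fin 6 → R) : List ℕ → List ℕ → List ℕ → R
  | _, [], _ => 1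
  | A, x :: U, B => letterWt e A x (U ++ B) * wordWt e (x :: A) U B

/-- Two words that contribute alike to the weight of a letter `x` next to them. -/
def SameContext (x : ℕ) (A B : List ℕ) : Prop :=
  (∀ l, ascCount x (l ++ A) = ascCount x (l ++ B)) ∧ (x < A.headD 0 ↔ x < B.headD 0)

lemma SameContext.append {x : ℕ} {A B : List ℕ} (h : SameContext x A B) (l : List ℕ) :
    SameContext x (l ++ A) (l ++ B) := by
  refine ⟨fun l' => by simpa using h.1 (l' ++ l), ?_⟩
  cases l with
  | nil => exact h.2
  | cons a l => simp

lemma ascCount_append_cons {x a : ℕ} (ha : a < x) (U V : List ℕ) :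
    ascCount x (U ++ a :: V) = ascCount x U + ascCount x (a :: V) := by
  induction U with
  | nil => simp [ascCount]
  | cons u U ih =>
    rw [List.cons_append, ascCount, ih, ascCount.eq_2 x u U]
    cases U with
    | nil => simp [ha.le]
    | cons b U => simp [add_assoc]

lemma ascCount_append_of_forall_lt {x : ℕ} (hx : 0 < x) {s : List ℕ} (hs : s ≠ [])
    (hlt : ∀ a ∈ s, a < x) (V : List ℕ) : ascCount x (s ++ V) = ascCount x (0 :: V) := by
  induction s with
  | nil => exact absurd rfl hs
  | cons a s ih =>
    have ha : a < x := hlt a (by simp)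
    cases s with
    | nil => simp [ascCount, ha, hx]
    | cons b s =>
      have hb : b < x := hlt b (by simp)
      rw [← ih (by simp) fun c hc => hlt c (List.mem_cons_of_mem _ hc), List.cons_append, ascCount]
      simp [hb.le]

lemma sameContext_of_forall_lt {x : ℕ} (hx : 0 < x) {s : List ℕ} (hs : s ≠ [])
    (hlt : ∀ a ∈ s, a < x) (V : List ℕ) : SameContext x (s ++ V) (0 :: V) := by
  have key := ascCount_append_of_forall_lt hx hs hlt V
  obtain ⟨a, s, rfl⟩ := List.exists_cons_of_ne_nil hs
  have ha : a < x := hlt a (by simp)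
  refine ⟨fun l => ?_, by simp [ha.le]⟩
  rw [List.cons_append] at key ⊢
  rw [ascCount_append_cons ha, ascCount_append_cons hx, key]

section Weights

variable {R : Type*} [CommRing R] (e : Fin 6 → R)

lemma letterWt_congr {A A' B B' : List ℕ} {x : ℕ} (hA : x ≠ 0 → SameContext x A A')
    (hB : x ≠ 0 → SameContext x B B') : letterWt e A x B = letterWt e A' x B' := by
  unfold letterWt
  by_cases h : x = 0
  · simp [h]
  · have h₁ := (hA h).1 []
    have h₂ := (hB h).1 []
    simp only [List.nil_append] at h₁ h₂
    simp only [h, if_false, h₁, h₂, (hA h).2, (hB h).2]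

lemma wordWt_congr {U : List ℕ} {A A' B B' : List ℕ} (hA : ∀ x ∈ U, x ≠ 0 → SameContext x A A')
    (hB : ∀ x ∈ U, x ≠ 0 → SameContext x B B') : wordWt e A U B = wordWt e A' U B' := by
  induction U generalizing A A' with
  | nil => rfl
  | cons x U ih =>
    have h := ih (A := x :: A) (A' := x :: A')
      (fun y hy h0 => (hA y (by simp [hy]) h0).append [x]) fun y hy => hB y (by simp [hy])
    rw [wordWt, wordWt, h, letterWt_congr e (hA x (by simp))
      fun hx => (hB x (by simp) hx).append U]

lemma wordWt_append (A U V B : List ℕ) :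
    wordWt e A (U ++ V) B = wordWt e A U (V ++ B) * wordWt e (U.reverse ++ A) V B := by
  induction U generalizing A with
  | nil => simp [wordWt]
  | cons x U ih => simp [wordWt, ih, mul_assoc]

lemma wordWt_zeros {s : List ℕ} (hs : ∀ a ∈ s, a = 0) (A B : List ℕ) : wordWt e A s B = 1 := by
  induction s generalizing A with
  | nil => rfl
  | cons x s ih =>
    rw [wordWt, ih fun a ha => hs a (by simp [ha])]
    simp [letterWt, hs x (by simp)]

/-- Inserting a letter `k`, smaller than all the others, at a separator. -/
lemma wordWt_insert {k : ℕ} {U V s₁ s₂ : List ℕ} (hU : ∀ x ∈ U, x ≠ 0 → k < x)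
    (hV : ∀ x ∈ V, x ≠ 0 → k < x) (h₁ : ∀ a ∈ s₁, a = 0) (h₂ : ∀ a ∈ s₂, a = 0) :
    wordWt e [] (U ++ (s₁ ++ k :: s₂) ++ V) [] =
      wordWt e [] (U ++ 0 :: V) [] * letterWt e (s₁.reverse ++ U.reverse) k (s₂ ++ V) := by
  have hs : ∀ x, k < x → ∀ a ∈ s₁ ++ k :: s₂, a < x := by
    intro x hx a ha
    simp only [List.mem_append, List.mem_cons] at ha
    rcases ha with ha | rfl | ha
    · have := h₁ a ha; omega
    · exact hx
    · have := h₂ a ha; omega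
  have hU' : wordWt e [] U ((s₁ ++ k :: s₂) ++ V) = wordWt e [] U (0 :: V) :=
    wordWt_congr e (fun _ _ _ => ⟨fun _ => rfl, Iff.rfl⟩) fun x hx h0 =>
      sameContext_of_forall_lt (by omega) (by simp) (hs x (hU x hx h0)) V
  have hV' : wordWt e ((s₁ ++ k :: s₂).reverse ++ U.reverse) V [] =
      wordWt e (0 :: U.reverse) V [] :=
    wordWt_congr e (fun x hx h0 => sameContext_of_forall_lt (by omega) (by simp)
      (fun a ha => hs x (hV x hx h0) a (List.mem_reverse.1 ha)) _)
      fun _ _ _ => ⟨fun _ => rfl, Iff.rfl⟩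
  have hmid : wordWt e U.reverse (s₁ ++ k :: s₂) V =
      letterWt e (s₁.reverse ++ U.reverse) k (s₂ ++ V) := by
    rw [wordWt_append, wordWt_zeros e h₁, wordWt, wordWt_zeros e h₂]
    simp
  rw [List.append_assoc, wordWt_append, wordWt_append e _ (s₁ ++ k :: s₂) V, List.append_nil,
    List.append_nil, List.append_nil, hU', hV', hmid, wordWt_append e [] U (0 :: V), wordWt]
  simp only [List.append_nil, show ∀ A B, letterWt e A 0 B = 1 from fun _ _ => by simp [letterWt]]
  ring

end Weights

/-! ### Lists of blocks -/

/-- The blocks, each preceded by a separator. -/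
def sepBefore (c : List (List ℕ)) : List ℕ := c.flatMap fun b => 0 :: b

/-- The blocks, each followed by a separator. -/
def sepAfter (c : List (List ℕ)) : List ℕ := c.flatMap fun b => b ++ [0]

/-- The blocks, separated and surrounded by separators. -/
def blockWord (c : List (List ℕ)) : List ℕ := sepBefore c ++ [0]

lemma sepBefore_append (c d : List (List ℕ)) :
    sepBefore (c ++ d) = sepBefore c ++ sepBefore d := by simp [sepBefore]

lemma sepAfter_append (c d : List (List ℕ)) :
    sepAfter (c ++ d) = sepAfter c ++ sepAfter d := by simp [sepAfter]

lemma blockWord_eq (c : List (List ℕ)) : blockWord c = 0 :: sepAfter c := by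
  induction c with
  | nil => rfl
  | cons b c ih => simp_all [blockWord, sepBefore, sepAfter]

lemma blockWord_append (L R : List (List ℕ)) :
    blockWord (L ++ R) = sepBefore L ++ 0 :: sepAfter R := by
  rw [← blockWord_eq, blockWord, blockWord, sepBefore_append, List.append_assoc]

lemma reverse_sepBefore (c : List (List ℕ)) :
    (sepBefore c).reverse = sepAfter (c.map List.reverse).reverse := by
  induction c with
  | nil => rfl
  | cons b c ih =>
    rw [List.map_cons, List.reverse_cons, sepAfter_append, ← ih]
    simp [sepBefore, sepAfter]

lemma ascCount_of_forall_lt {k : ℕ} {b : List ℕ} (hb : ∀ x ∈ b, k < x) : ascCount k b = 0 := by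
  induction b with
  | nil => rfl
  | cons a b ih =>
    have ha : k < a := hb a (by simp)
    rw [ascCount, ih fun x hx => hb x (by simp [hx])]
    simp [ha.le]

lemma ascCount_sepAfter {k : ℕ} (hk : 0 < k) {R : List (List ℕ)} (hR : [] ∉ R)
    (hlt : ∀ b ∈ R, ∀ x ∈ b, k < x) {b : List ℕ} (hb : ∀ x ∈ b, k < x) :
    ascCount k (b ++ 0 :: sepAfter R) = R.length := by
  rw [ascCount_append_cons hk, ascCount_of_forall_lt hb, zero_add]
  induction R generalizing b with
  | nil => simp [sepAfter, ascCount]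
  | cons c R ih =>
    simp only [List.mem_cons, not_or] at hR
    obtain ⟨a, c, rfl⟩ := List.exists_cons_of_ne_nil (Ne.symm hR.1)
    have ha : k < a := hlt (a :: c) (by simp) a (by simp)
    have hc : ∀ x ∈ a :: c, k < x := hlt _ (by simp)
    have h := ih hR.2 (fun b hb => hlt b (by simp [hb])) (b := []) (by simp)
    have h' : sepAfter ((a :: c) :: R) = (a :: c) ++ 0 :: sepAfter R := by simp [sepAfter]
    rw [ascCount, h', ascCount_append_cons hk, ascCount_of_forall_lt hc, h]
    simp [hk, ha, add_comm]

/-- The block `b`, dropped if it is empty. -/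
def optBlock (b : List ℕ) : List (List ℕ) := if b = [] then [] else [b]

lemma flatten_optBlock (b : List ℕ) : (optBlock b).flatten = b := by
  unfold optBlock; split_ifs with h <;> simp [h]

lemma nil_notMem_optBlock (b : List ℕ) : [] ∉ optBlock b := by
  unfold optBlock; split_ifs with h
  · simp
  · simpa using Ne.symm h

/-- The weight contributed by the smallest letter, according to whether it has a left and a right
neighbour in its block. -/
def typeWt {R : Type*} [CommRing R] (e : Fin 6 → R) : Bool → Bool → R
  | false, false => 1
  | false, true => e 3
  | true, false => e 2 * e 4
  | true, true => e 2 * e 5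

lemma wordWt_blockWord_insert {A : Type*} [CommRing A] (e : Fin 6 → A) {k : ℕ} (hk : 0 < k)
    {L R : List (List ℕ)} {l r : List ℕ} (hL : [] ∉ L) (hR : [] ∉ R)
    (hlt : ∀ x ∈ (L ++ (optBlock l ++ (optBlock r ++ R))).flatten, k < x) :
    wordWt e [] (blockWord (L ++ (l ++ k :: r) :: R)) [] =
      e 0 ^ R.length * e 1 ^ L.length * typeWt e (!l.isEmpty) (!r.isEmpty) *
        wordWt e [] (blockWord (L ++ (optBlock l ++ (optBlock r ++ R)))) [] := by
  simp only [List.flatten_append, flatten_optBlock, List.mem_append, List.mem_flatten] at hlt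
  have hltL : ∀ b ∈ L, ∀ x ∈ b, k < x := fun b hb x hx => hlt x (.inl ⟨b, hb, hx⟩)
  have hltR : ∀ b ∈ R, ∀ x ∈ b, k < x := fun b hb x hx => hlt x (.inr (.inr (.inr ⟨b, hb, hx⟩)))
  have hltl : ∀ x ∈ l, k < x := fun x hx => hlt x (.inr (.inl hx))
  have hltr : ∀ x ∈ r, k < x := fun x hx => hlt x (.inr (.inr (.inl hx)))
  set U := sepBefore L ++ sepBefore (optBlock l) with hU
  set V := sepAfter (optBlock r) ++ sepAfter R with hV
  set s₁ : List ℕ := if l = [] then [0] else [] with hs₁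
  set s₂ : List ℕ := if r = [] then [0] else [] with hs₂
  have hU₁ : U ++ s₁ = sepBefore L ++ 0 :: l := by
    by_cases h : l = [] <;> simp [hU, hs₁, h, optBlock, sepBefore]
  have hV₂ : s₂ ++ V = r ++ 0 :: sepAfter R := by
    by_cases h : r = [] <;> simp [hV, hs₂, h, optBlock, sepAfter]
  have hU₁' : s₁.reverse ++ U.reverse =
      l.reverse ++ 0 :: sepAfter (L.map List.reverse).reverse := by
    rw [← List.reverse_append, hU₁, ← reverse_sepBefore]; simp
  have hsrc : blockWord (L ++ (optBlock l ++ (optBlock r ++ R))) = U ++ 0 :: V := by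
    rw [← List.append_assoc, blockWord_append, sepBefore_append, sepAfter_append]
  have htgt : blockWord (L ++ (l ++ k :: r) :: R) = U ++ (s₁ ++ k :: s₂) ++ V := by
    rw [show U ++ (s₁ ++ k :: s₂) ++ V = (U ++ s₁) ++ k :: (s₂ ++ V) by simp, hU₁, hV₂,
      blockWord_append]
    simp [sepAfter]
  have hkU : ∀ x ∈ U, x ≠ 0 → k < x := by
    intro x hx h0
    simp only [hU, sepBefore, List.mem_append, List.mem_flatMap, List.mem_cons, h0, false_or,
      optBlock] at hx
    rcases hx with ⟨b, hb, hx⟩ | ⟨b, hb, hx⟩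
    · exact hltL b hb x hx
    · split_ifs at hb
      · simp at hb
      · exact hltl x (by simp_all)
  have hkV : ∀ x ∈ V, x ≠ 0 → k < x := by
    intro x hx h0
    simp only [hV, sepAfter, List.mem_append, List.mem_flatMap, List.mem_singleton, h0, or_false,
      optBlock] at hx
    rcases hx with ⟨b, hb, hx⟩ | ⟨b, hb, hx⟩
    · split_ifs at hb
      · simp at hb
      · exact hltr x (by simp_all)
    · exact hltR b hb x hx
  rw [htgt, hsrc, wordWt_insert e hkU hkV (by intro a; simp only [hs₁]; split_ifs <;> simp)
    (by intro a; simp only [hs₂]; split_ifs <;> simp), hU₁', hV₂, letterWt, if_neg hk.ne',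
    ascCount_sepAfter hk hR hltR hltr, ascCount_sepAfter hk _ _ (by simpa using hltl), mul_comm]
  · congr 1
    rw [List.length_reverse, List.length_map]
    congr 1
    have hl : (l.reverse ++ 0 :: sepAfter (L.map List.reverse).reverse).headD 0 = l.getLastD 0 := by
      rcases List.eq_nil_or_concat l with rfl | ⟨l, a, rfl⟩ <;> simp
    have hr : (r ++ 0 :: sepAfter R).headD 0 = r.headD 0 := by cases r <;> simp
    have hl' : k < l.getLastD 0 ↔ (!l.isEmpty) = true := by
      rcases List.eq_nil_or_concat l with rfl | ⟨l, a, rfl⟩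
      · simp
      · simpa using hltl a (by simp)
    have hr' : k < r.headD 0 ↔ (!r.isEmpty) = true := by
      cases r with
      | nil => simp
      | cons b r => simpa using hltr b (by simp)
    simp only [hl, hr, hl', hr']
    cases !l.isEmpty <;> cases !r.isEmpty <;> simp [typeWt]
  · simpa using hL
  · intro b hb x hx
    simp only [List.mem_reverse, List.mem_map] at hb
    obtain ⟨b, hb, rfl⟩ := hb
    exact hltL b hb x (by simpa using hx)

/-! ### Summing over lists of blocks -/

lemma finite_setOf_forall_mem_length_le {α : Type*} {s : Set α} (hs : s.Finite) (n : ℕ) :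
    {l : List α | (∀ x ∈ l, x ∈ s) ∧ l.length ≤ n}.Finite := by
  have : Finite s := hs
  refine ((List.finite_length_le s n).image (List.map Subtype.val)).subset ?_
  rintro l ⟨hl, hn⟩
  exact ⟨l.attachWith _ hl, by simpa using hn, by simp⟩

/-- Lists of `m` nonempty blocks such that every element of `S` occurs once, and nothing else. -/
def blockConfigSet (S : Finset ℕ) (m : ℕ) : Set (List (List ℕ)) :=
  {c | [] ∉ c ∧ (c.flatten : Multiset ℕ) = S.val ∧ c.length = m}

lemma finite_blockConfigSet (S : Finset ℕ) (m : ℕ) : (blockConfigSet S m).Finite := by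
  refine (finite_setOf_forall_mem_length_le
    (finite_setOf_forall_mem_length_le S.finite_toSet S.card) m).subset ?_
  rintro c ⟨-, hS, hm⟩
  refine ⟨fun b hb => ⟨fun x hx => ?_, ?_⟩, hm.le⟩
  · have : x ∈ S.val := hS ▸ Multiset.mem_coe.2 (List.mem_flatten.2 ⟨b, hb, hx⟩)
    exact this
  · have : c.flatten.length = S.card := by rw [← Multiset.coe_card, hS, Finset.card_def]
    exact (List.sublist_flatten_of_mem hb).length_le.trans this.le

/-- `blockConfigSet` as a `Finset`. -/
def blockConfigs (S : Finset ℕ) (m : ℕ) : Finset (List (List ℕ)) :=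
  (finite_blockConfigSet S m).toFinset

lemma mem_blockConfigs {S : Finset ℕ} {m : ℕ} {c : List (List ℕ)} :
    c ∈ blockConfigs S m ↔ [] ∉ c ∧ (c.flatten : Multiset ℕ) = S.val ∧ c.length = m := by
  simp [blockConfigs, blockConfigSet]

lemma eq_of_append_cons_eq {α : Type*} {P : α → Prop} {A A' B B' : List α} {x x' : α}
    (h : A ++ x :: B = A' ++ x' :: B') (hx : P x) (hx' : P x') (hA : ∀ a ∈ A, ¬P a)
    (hA' : ∀ a ∈ A', ¬P a) : A = A' ∧ x = x' ∧ B = B' := by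
  induction A generalizing A' with
  | nil =>
    cases A' with
    | nil => simpa using h
    | cons a A' =>
      simp only [List.nil_append, List.cons_append, List.cons.injEq] at h
      exact absurd (h.1 ▸ hx) (hA' a (by simp))
  | cons a A ih =>
    cases A' with
    | nil =>
      simp only [List.nil_append, List.cons_append, List.cons.injEq] at h
      exact absurd (h.1 ▸ hx') (hA a (by simp))
    | cons a' A' =>
      simp only [List.cons_append, List.cons.injEq] at h
      have := ih h.2 (fun b hb => hA b (by simp [hb])) fun b hb => hA' b (by simp [hb])
      exact ⟨by rw [h.1, this.1], this.2⟩

/-- Insert `k` into the `j`-th block of the resulting list of blocks, absorbing a former block on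
its left if `a` and a former block on its right if `b`. -/
def insertLetter (k j : ℕ) (a b : Bool) (c : List (List ℕ)) : List (List ℕ) :=
  c.take j ++ ((if a then (c.drop j).headD [] else []) ++
    k :: (if b then (c.drop (j + a.toNat)).headD [] else [])) :: c.drop (j + a.toNat + b.toNat)

lemma insertLetter_append (k : ℕ) (L R : List (List ℕ)) (l r : List ℕ) :
    insertLetter k L.length (!l.isEmpty) (!r.isEmpty) (L ++ (optBlock l ++ (optBlock r ++ R))) =
      L ++ (l ++ k :: r) :: R := by
  rcases l with _ | ⟨x, l⟩ <;> rcases r with _ | ⟨y, r⟩ <;>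
    simp [insertLetter, optBlock, add_assoc]

lemma exists_eq_append_optBlock {m j : ℕ} {a b : Bool} {c : List (List ℕ)} (hc : [] ∉ c)
    (hlen : c.length = m + a.toNat + b.toNat) (hj : j ≤ m) :
    ∃ L l r R, L.length = j ∧ R.length = m - j ∧ (!l.isEmpty) = a ∧ (!r.isEmpty) = b ∧
      c = L ++ (optBlock l ++ (optBlock r ++ R)) := by
  obtain ⟨L, D, rfl, hL⟩ : ∃ L D, c = L ++ D ∧ L.length = j :=
    ⟨c.take j, c.drop j, by simp, by simp; omega⟩
  have split : ∀ (a : Bool) (D : List (List ℕ)) (n : ℕ), [] ∉ D → D.length = n + a.toNat →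
      ∃ l D', (!l.isEmpty) = a ∧ D = optBlock l ++ D' ∧ D'.length = n ∧ [] ∉ D' := by
    rintro (_ | _) D n h0 hD
    · exact ⟨[], D, rfl, rfl, hD, h0⟩
    · obtain _ | ⟨l, D⟩ := D
      · simp at hD
      · simp only [List.mem_cons, not_or] at h0
        exact ⟨l, D, by simpa using Ne.symm h0.1, by simp [optBlock, Ne.symm h0.1],
          by simpa using hD, h0.2⟩
  simp only [List.mem_append, not_or, List.length_append] at hc hlen
  obtain ⟨l, D, ha, rfl, hD, h0⟩ := split a D (m - j + b.toNat) hc.2 (by omega)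
  obtain ⟨r, R, hb, rfl, hR, -⟩ := split b D (m - j) h0 hD
  exact ⟨L, l, r, R, hL, hR, ha, hb, rfl⟩

lemma length_optBlock (b : List ℕ) : (optBlock b).length = (!b.isEmpty).toNat := by
  cases b <;> simp [optBlock]

lemma mem_blockConfigs_insert {k : ℕ} {S : Finset ℕ} (hk : k ∉ S) {m : ℕ} {L R : List (List ℕ)}
    {l r : List ℕ} (hm : L.length + R.length = m) :
    L ++ (l ++ k :: r) :: R ∈ blockConfigs (insert k S) (m + 1) ↔
      L ++ (optBlock l ++ (optBlock r ++ R)) ∈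
        blockConfigs S (m + (!l.isEmpty).toNat + (!r.isEmpty).toNat) := by
  have h : ((L ++ (l ++ k :: r) :: R).flatten : Multiset ℕ) =
      k ::ₘ ((L ++ (optBlock l ++ (optBlock r ++ R))).flatten : Multiset ℕ) := by
    rw [Multiset.cons_coe, Multiset.coe_eq_coe]
    simp only [List.flatten_append, List.flatten_cons, flatten_optBlock]
    simpa using List.perm_middle (l₁ := L.flatten ++ l) (l₂ := r ++ R.flatten) (a := k)
  rw [mem_blockConfigs, mem_blockConfigs, h, Finset.insert_val_of_notMem hk,
    Multiset.cons_inj_right]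
  have hl := nil_notMem_optBlock l
  have hr := nil_notMem_optBlock r
  simp only [List.mem_append, List.mem_cons, List.length_append, List.length_cons,
    length_optBlock, hl, hr, false_or]
  simp only [List.nil_eq, List.append_eq_nil_iff, reduceCtorEq, and_false, false_or]
  refine and_congr_right fun _ => and_congr_right fun _ => ?_
  omega

section Recurrence

variable {A : Type*} [CommRing A] (e : Fin 6 → A)

/-- The total weight of the lists of `m` blocks on the set `S`. -/
def configSum (S : Finset ℕ) (m : ℕ) : A :=
  ∑ c ∈ blockConfigs S m, wordWt e [] (blockWord c) []

lemma configSum_empty (m : ℕ) : configSum e ∅ m = if m = 0 then 1 else 0 := by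
  have h : blockConfigs ∅ m = if m = 0 then {[]} else ∅ := by
    ext c
    rw [mem_blockConfigs]
    rcases c with _ | ⟨b, c⟩
    · split_ifs with hm <;> simp [hm, eq_comm]
    · have : ¬([] ∉ b :: c ∧ ((b :: c).flatten : Multiset ℕ) = (∅ : Finset ℕ).val ∧
          (b :: c).length = m) := by
        rintro ⟨h0, h, -⟩
        simp only [List.mem_cons, not_or] at h0
        simp_all
      simp only [this, false_iff]
      split_ifs <;> simp
  rw [configSum, h]
  split_ifs <;> simp [blockWord, sepBefore, wordWt, letterWt]

lemma configSum_insert_zero (k : ℕ) (S : Finset ℕ) : configSum e (insert k S) 0 = 0 := by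
  refine Finset.sum_eq_zero fun c hc => ?_
  obtain ⟨-, h, h'⟩ := mem_blockConfigs.1 hc
  rw [List.length_eq_zero_iff] at h'
  subst h'
  have : k ∈ (insert k S).val := Finset.mem_insert_self k S
  rw [← h] at this
  simp at this

lemma configSum_insert_succ {k : ℕ} (hk : 0 < k) {S : Finset ℕ} (hS : ∀ x ∈ S, k < x) (m : ℕ) :
    configSum e (insert k S) (m + 1) = pqInt (e 0) (e 1) (m + 1) *
      (configSum e S m + (e 3 + e 2 * e 4) * configSum e S (m + 1) +
        e 2 * e 5 * configSum e S (m + 2)) := by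
  have hkS : k ∉ S := fun h => (hS k h).false
  have hlt : ∀ {m' : ℕ} {c : List (List ℕ)}, c ∈ blockConfigs S m' → ∀ x ∈ c.flatten, k < x := by
    intro m' c hc x hx
    refine hS x ?_
    rw [← Finset.mem_val, ← (mem_blockConfigs.1 hc).2.1]
    exact hx
  have key : configSum e (insert k S) (m + 1) =
      ∑ x ∈ (Finset.range (m + 1) ×ˢ (Finset.univ : Finset (Bool × Bool))).sigma
        (fun x => blockConfigs S (m + x.2.1.toNat + x.2.2.toNat)),
        e 0 ^ (m - x.1.1) * e 1 ^ x.1.1 * typeWt e x.1.2.1 x.1.2.2 *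
          wordWt e [] (blockWord x.2) [] := by
    symm
    refine Finset.sum_bij (fun x _ => insertLetter k x.1.1 x.1.2.1 x.1.2.2 x.2) ?_ ?_ ?_ ?_
    · rintro ⟨⟨j, a, b⟩, c⟩ h
      simp only [Finset.mem_sigma, Finset.mem_product, Finset.mem_range, Finset.mem_univ,
        and_true] at h ⊢
      obtain ⟨hj, hc⟩ := h
      have hc' := mem_blockConfigs.1 hc
      obtain ⟨L, l, r, R, rfl, hR, rfl, rfl, rfl⟩ :=
        exists_eq_append_optBlock hc'.1 hc'.2.2 (Nat.lt_succ_iff.1 hj)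
      rw [insertLetter_append]
      exact (mem_blockConfigs_insert hkS (by omega)).2 hc
    · rintro ⟨⟨j, a, b⟩, c⟩ h ⟨⟨j', a', b'⟩, c'⟩ h' heq
      simp only [Finset.mem_sigma, Finset.mem_product, Finset.mem_range, Finset.mem_univ,
        and_true] at h h' heq
      obtain ⟨hj, hc⟩ := h
      obtain ⟨hj', hc'⟩ := h'
      have hd := mem_blockConfigs.1 hc
      have hd' := mem_blockConfigs.1 hc'
      have hn : ∀ x ∈ c.flatten, x ≠ k := fun x hx => (hlt hc x hx).ne'
      have hn' : ∀ x ∈ c'.flatten, x ≠ k := fun x hx => (hlt hc' x hx).ne'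
      obtain ⟨L, l, r, R, rfl, hR, rfl, rfl, rfl⟩ :=
        exists_eq_append_optBlock hd.1 hd.2.2 (Nat.lt_succ_iff.1 hj)
      obtain ⟨L', l', r', R', rfl, hR', rfl, rfl, rfl⟩ :=
        exists_eq_append_optBlock hd'.1 hd'.2.2 (Nat.lt_succ_iff.1 hj')
      rw [insertLetter_append, insertLetter_append] at heq
      simp only [List.flatten_append, flatten_optBlock, List.mem_append, List.mem_flatten] at hn hn'
      obtain ⟨rfl, h2, rfl⟩ := eq_of_append_cons_eq (P := (k ∈ ·)) heq (by simp) (by simp)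
        (fun b hb hkb => hn k (.inl ⟨b, hb, hkb⟩) rfl)
        fun b hb hkb => hn' k (.inl ⟨b, hb, hkb⟩) rfl
      obtain ⟨rfl, -, rfl⟩ := eq_of_append_cons_eq (P := (· = k)) h2 rfl rfl
        (fun x hx => hn x (.inr (.inl hx))) fun x hx => hn' x (.inr (.inl hx))
      rfl
    · intro c hc
      have hc' := mem_blockConfigs.1 hc
      have hkc : k ∈ c.flatten := by
        rw [← Multiset.mem_coe, hc'.2.1]
        exact Finset.mem_insert_self k S
      obtain ⟨B, hB, hkB⟩ := List.mem_flatten.1 hkc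
      obtain ⟨L, R, rfl⟩ := List.append_of_mem hB
      obtain ⟨l, r, rfl⟩ := List.append_of_mem hkB
      have hm : L.length + R.length = m := by
        have := hc'.2.2
        simp only [List.length_append, List.length_cons] at this
        omega
      refine ⟨⟨(L.length, !l.isEmpty, !r.isEmpty), L ++ (optBlock l ++ (optBlock r ++ R))⟩,
        ?_, insertLetter_append k L R l r⟩
      simp only [Finset.mem_sigma, Finset.mem_product, Finset.mem_range, Finset.mem_univ,
        and_true]
      exact ⟨by omega, (mem_blockConfigs_insert hkS hm).1 hc⟩
    · rintro ⟨⟨j, a, b⟩, c⟩ h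
      simp only [Finset.mem_sigma, Finset.mem_product, Finset.mem_range, Finset.mem_univ,
        and_true] at h ⊢
      obtain ⟨hj, hc⟩ := h
      have hc' := mem_blockConfigs.1 hc
      have hkc := hlt hc
      obtain ⟨L, l, r, R, rfl, hR, rfl, rfl, rfl⟩ :=
        exists_eq_append_optBlock hc'.1 hc'.2.2 (Nat.lt_succ_iff.1 hj)
      rw [insertLetter_append, wordWt_blockWord_insert e hk _ _ hkc, hR]
      · exact fun h => hc'.1 (by simp [h])
      · exact fun h => hc'.1 (by simp [h])
  rw [key, Finset.sum_sigma, Finset.sum_product, pqInt, Finset.sum_mul]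
  refine Finset.sum_congr rfl fun j _ => ?_
  simp only [← Finset.mul_sum]
  simp only [Fintype.sum_prod_type, Fintype.sum_bool, typeWt, Bool.toNat_true, Bool.toNat_false,
    add_zero, Nat.add_sub_cancel, configSum]
  ring

end Recurrence

/-! ### Motzkin paths -/

section Paths

variable {A : Type*} [CommRing A] (e : Fin 6 → A)

/-- The total weight of the Motzkin paths with `N` steps from height `h` to height `0`. -/
def pathSum : ℕ → ℤ → A
  | 0, h => if h = 0 then 1 else 0
  | N + 1, h => if h < 0 then 0 else pqInt (e 0) (e 1) (h.toNat + 1) *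
      (e 2 * e 5 * pathSum N (h + 1) + (e 3 + e 2 * e 4) * pathSum N h + pathSum N (h - 1))

lemma pathSum_of_neg {h : ℤ} (hh : h < 0) (N : ℕ) : pathSum e N h = 0 := by
  cases N with
  | zero => simp [pathSum, hh.ne]
  | succ N => simp [pathSum, hh]

lemma configSum_zero {S : Finset ℕ} (hS : S.Nonempty) : configSum e S 0 = 0 := by
  obtain ⟨k, hk⟩ := hS
  simpa [Finset.insert_eq_of_mem hk] using configSum_insert_zero e k S

lemma configSum_eq_pathSum (S : Finset ℕ) :
    (∀ x ∈ S, 0 < x) → ∀ N, S.card = N + 1 → ∀ h : ℕ,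
      configSum e S (h + 1) = pathSum e N h := by
  induction S using Finset.induction_on_min with
  | empty => intro _ N hN; simp at hN
  | insert k S hS ih =>
    intro hpos N hN h
    have hkS : k ∉ S := fun h => (hS k h).false
    rw [Finset.card_insert_of_notMem hkS, add_left_inj] at hN
    rw [configSum_insert_succ e (hpos k (Finset.mem_insert_self _ _)) hS]
    have ih' := ih fun x hx => hpos x (Finset.mem_insert_of_mem hx)
    cases N with
    | zero =>
      rw [Finset.card_eq_zero] at hN
      subst hN
      simp only [configSum_empty, pathSum]
      rcases h with _ | h
      · simp [pqInt]
      · have : ¬((h : ℤ) + 1 = 0) := by omega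
        simp [this]
    | succ N =>
      have hne : S.Nonempty := Finset.card_pos.1 (by omega)
      have h1 := ih' N hN
      rw [pathSum, if_neg (by omega), Int.toNat_natCast, h1 h,
        show h + 2 = (h + 1) + 1 from rfl, h1 (h + 1)]
      have h2 : configSum e S h = pathSum e N ((h : ℤ) - 1) := by
        cases h with
        | zero => rw [configSum_zero e hne, pathSum_of_neg e (by simp)]
        | succ h => rw [h1 h]; congr 1; push_cast; ring
      rw [h2]
      push_cast
      ring

lemma hgt_zero (N : ℕ) (γ : Fin N → Fin 3) : hgt N γ 0 = 0 := by simp [hgt]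

lemma hgt_cons (N : ℕ) (s : Fin 3) (γ : Fin N → Fin 3) (i : ℕ) :
    hgt (N + 1) (Fin.cons s γ) (i + 1) = 1 - ((s : ℕ) : ℤ) + hgt N γ i := by
  rw [hgt, Finset.sum_range_succ', hgt, add_comm]
  congr 1
  refine Finset.sum_congr rfl fun j _ => ?_
  by_cases hj : j < N
  · have : (⟨j + 1, by omega⟩ : Fin (N + 1)) = Fin.succ ⟨j, hj⟩ := rfl
    simp only [hj, dif_pos, Nat.add_lt_add_right hj 1, this, Fin.cons_succ]
  · simp [hj]

lemma neCount_cons (N : ℕ) (s : Fin 3) (γ : Fin N → Fin 3) :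
    neCount (N + 1) (Fin.cons s γ) = (if s = 0 then 1 else 0) + neCount N γ := by
  rw [neCount, neCount, Finset.card_filter, Finset.card_filter, Fin.sum_univ_succ]
  simp only [Fin.cons_zero, Fin.cons_succ]

lemma eCount_cons (N : ℕ) (s : Fin 3) (γ : Fin N → Fin 3) :
    eCount (N + 1) (Fin.cons s γ) = (if s = 1 then 1 else 0) + eCount N γ := by
  rw [eCount, eCount, Finset.card_filter, Finset.card_filter, Fin.sum_univ_succ]
  simp only [Fin.cons_zero, Fin.cons_succ]

/-- The weight of a path starting at height `h`. -/
def pathWt (N : ℕ) (h : ℤ) (γ : Fin N → Fin 3) : A :=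
  (e 2 * e 5) ^ neCount N γ * (e 3 + e 2 * e 4) ^ eCount N γ *
    ∏ i : Fin N, pqInt (e 0) (e 1) ((h + hgt N γ i).toNat + 1)

lemma pathWt_cons (N : ℕ) (h : ℤ) (s : Fin 3) (γ : Fin N → Fin 3) :
    pathWt e (N + 1) h (Fin.cons s γ) = pqInt (e 0) (e 1) (h.toNat + 1) *
      ((if s = 0 then e 2 * e 5 else if s = 1 then e 3 + e 2 * e 4 else 1) *
        pathWt e N (h + (1 - ((s : ℕ) : ℤ))) γ) := by
  simp only [pathWt, neCount_cons, eCount_cons, Fin.prod_univ_succ, Fin.val_zero, hgt_zero,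
    Fin.val_succ, hgt_cons, add_zero, pow_add, add_assoc]
  fin_cases s <;> simp <;> ring

lemma pathSum_eq_sum (N : ℕ) (h : ℤ) :
    pathSum e N h = ∑ γ : Fin N → Fin 3,
      if (∀ i ≤ N, 0 ≤ h + hgt N γ i) ∧ h + hgt N γ N = 0 then pathWt e N h γ else 0 := by
  induction N generalizing h with
  | zero =>
    simp only [pathSum, Nat.le_zero, forall_eq, hgt_zero, add_zero]
    rcases eq_or_ne h 0 with rfl | hh
    · simp [pathWt, neCount, eCount]
    · simp [hh]
  | succ N ih =>
    rw [← (Fin.consEquiv fun _ => Fin 3).sum_comp, Fintype.sum_prod_type, pathSum]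
    have hcond : ∀ (s : Fin 3) (γ : Fin N → Fin 3),
        ((∀ i ≤ N + 1, 0 ≤ h + hgt (N + 1) (Fin.cons s γ) i) ∧
          h + hgt (N + 1) (Fin.cons s γ) (N + 1) = 0) ↔ 0 ≤ h ∧
        ((∀ i ≤ N, 0 ≤ h + (1 - ((s : ℕ) : ℤ)) + hgt N γ i) ∧
          h + (1 - ((s : ℕ) : ℤ)) + hgt N γ N = 0) := by
      intro s γ
      rw [hgt_cons, ← and_assoc, ← add_assoc]
      refine and_congr_left fun _ => ⟨fun H => ⟨by simpa [hgt_zero] using H 0 (by omega),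
        fun i hi => ?_⟩, fun H i hi => ?_⟩
      · have := H (i + 1) (by omega)
        rwa [hgt_cons, ← add_assoc] at this
      · cases i with
        | zero => simpa [hgt_zero] using H.1
        | succ i => rw [hgt_cons, ← add_assoc]; exact H.2 i (by omega)
    have hcons : ∀ (s : Fin 3) (γ : Fin N → Fin 3),
        (Fin.consEquiv fun _ => Fin 3) (s, γ) = Fin.cons s γ := fun _ _ => rfl
    simp only [hcons, hcond, pathWt_cons]
    by_cases hh : h < 0
    · simp [hh, hh.not_ge]
    · simp only [hh, if_false, not_lt.1 hh, true_and, ← mul_ite_zero, ← Finset.mul_sum, ← ih]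
      rw [Fin.sum_univ_three]
      simp [sub_eq_add_neg, add_assoc]

lemma sum_motzkin_eq_pathSum (N : ℕ) :
    ∑ γ ∈ motzkin N, (e 2 * e 5) ^ neCount N γ * (e 3 + e 2 * e 4) ^ eCount N γ *
      ∏ i : Fin N, pqInt (e 0) (e 1) ((hgt N γ (i : ℕ)).toNat + 1) = pathSum e N 0 := by
  rw [pathSum_eq_sum, motzkin, Finset.sum_filter]
  refine Finset.sum_congr rfl fun γ _ => ?_
  simp only [zero_add, pathWt]
  exact if_congr Iff.rfl rfl rfl

end Paths

/-! ### Permutations as words -/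

lemma pext_eq_zero {n : ℕ} (σ : Equiv.Perm (Fin n)) {i : ℕ} (hi : ¬(1 ≤ i ∧ i ≤ n)) :
    pext n σ i = 0 := dif_neg hi

lemma pext_succ {n : ℕ} (σ : Equiv.Perm (Fin n)) (i : Fin n) :
    pext n σ (i + 1) = σ i + 1 := by
  rw [pext, dif_pos ⟨by omega, by omega⟩]
  rfl

lemma pext_mem_Icc {n : ℕ} (σ : Equiv.Perm (Fin n)) {i : ℕ} (hi : i ∈ Finset.Icc 1 n) :
    pext n σ i ∈ Finset.Icc 1 n := by
  rw [Finset.mem_Icc] at hi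
  rw [pext, dif_pos hi, Finset.mem_Icc]
  omega

lemma pext_injOn {n : ℕ} (σ : Equiv.Perm (Fin n)) :
    Set.InjOn (pext n σ) (Finset.Icc 1 n : Finset ℕ) := by
  intro i hi j hj h
  simp only [Finset.coe_Icc, Set.mem_Icc] at hi hj
  rw [pext, pext, dif_pos hi, dif_pos hj, add_left_inj, Fin.val_inj, σ.injective.eq_iff,
    Fin.mk.injEq] at h
  omega

lemma pext_ne_succ {n : ℕ} (σ : Equiv.Perm (Fin n)) {i j : ℕ} (hi : i ∈ Finset.Icc 1 n)
    (hij : i ≠ j) : pext n σ i ≠ pext n σ j := by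
  intro h
  by_cases hj : j ∈ Finset.Icc 1 n
  · exact hij (pext_injOn σ hi hj h)
  · have h1 := Finset.mem_Icc.1 (pext_mem_Icc σ hi)
    rw [h, pext_eq_zero σ (by simpa using hj)] at h1
    omega

/-- The word `σ(1) ⋯ σ(n)`. -/
def permWord (n : ℕ) (σ : Equiv.Perm (Fin n)) : List ℕ := (List.range' 1 n).map (pext n σ)

lemma coe_permWord (n : ℕ) (σ : Equiv.Perm (Fin n)) :
    (permWord n σ : Multiset ℕ) = (Finset.Icc 1 n).val := by
  have h : (Finset.Icc 1 n).image (pext n σ) = Finset.Icc 1 n :=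
    Finset.eq_of_subset_of_card_le (Finset.image_subset_iff.2 fun _ hi => pext_mem_Icc σ hi)
      (Finset.card_image_of_injOn (pext_injOn σ)).ge
  have h' := Finset.image_val_of_injOn (pext_injOn σ)
  rw [h] at h'
  rw [h', permWord, ← Multiset.map_coe]
  rfl

lemma permWord_injective (n : ℕ) : Function.Injective (permWord n) := by
  intro σ τ h
  rw [permWord, permWord, List.map_inj_left] at h
  ext i
  have := h (i + 1) (by simp [List.mem_range'_1]; omega)
  rw [pext_succ, pext_succ] at this
  omega

lemma exists_permWord_eq {n : ℕ} {w : List ℕ} (hw : (w : Multiset ℕ) = (Finset.Icc 1 n).val) :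
    ∃ σ, permWord n σ = w := by
  have hlen : w.length = n := by
    rw [← Multiset.coe_card, hw, ← Finset.card_def, Nat.card_Icc, Nat.add_sub_cancel]
  have hnd : w.Nodup := by
    rw [← Multiset.coe_nodup, hw]
    exact Finset.nodup _
  have hmem : ∀ x ∈ w, 1 ≤ x ∧ x ≤ n := by
    intro x hx
    rw [← Finset.mem_Icc, ← Finset.mem_val, ← hw]
    exact hx
  have hmem' : ∀ i (hi : i < w.length), 1 ≤ w[i] ∧ w[i] ≤ n := fun i hi =>
    hmem _ (List.getElem_mem hi)
  let f : Fin n → Fin n := fun i =>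
    ⟨w[(i : ℕ)]'(by omega) - 1, by have := hmem' i (by omega); omega⟩
  have hf : Function.Injective f := by
    intro i j hij
    simp only [f, Fin.mk.injEq] at hij
    have h1 := hmem' i (by omega)
    have h2 := hmem' j (by omega)
    exact Fin.ext ((hnd.getElem_inj_iff (hi := by omega) (hj := by omega)).1 (by omega))
  refine ⟨Equiv.ofBijective f (Finite.injective_iff_bijective.1 hf), ?_⟩
  refine List.ext_getElem (by simp [permWord, hlen]) fun i h1 h2 => ?_
  have hi : i < n := by omega
  have h3 := hmem' i h2
  have h4 := pext_succ (Equiv.ofBijective f (Finite.injective_iff_bijective.1 hf)) ⟨i, hi⟩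
  simp only [permWord, List.getElem_map, List.getElem_range', one_mul, add_comm 1 i]
  simp only [Equiv.ofBijective_apply, f] at h4
  rw [h4]
  omega

lemma ascCount_map_range' {f : ℕ → ℕ} {x : ℕ} (a len : ℕ) (h : f (a + len) ≤ x) :
    ascCount x ((List.range' a len).map f) =
      ((Finset.Ico a (a + len)).filter fun j => f j < x ∧ x < f (j + 1)).card := by
  induction len generalizing a with
  | zero => simp [ascCount]
  | succ len ih =>
    rw [List.range'_succ, List.map_cons, ascCount, ih (a + 1) (by convert h using 2; ring),
      Finset.card_filter, Finset.card_filter, show a + 1 + len = a + (len + 1) by ring,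
      Finset.sum_eq_sum_Ico_succ_bot (by omega : a < a + (len + 1))]
    cases len with
    | zero => simp [h.not_gt]
    | succ len => simp [List.range'_succ]

lemma ascCount_reverse_map_range {f : ℕ → ℕ} {x : ℕ} (hf : f 0 ≤ x) (m : ℕ) :
    ascCount x ((List.range m).map f).reverse =
      ((Finset.range m).filter fun j => f j < x ∧ x < f (j - 1)).card := by
  induction m with
  | zero => simp [ascCount]
  | succ m ih =>
    rw [List.range_succ, List.map_append, List.reverse_append, List.map_singleton,
      List.reverse_singleton, List.singleton_append, ascCount, ih, Finset.card_filter,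
      Finset.card_filter, Finset.sum_range_succ, add_comm]
    cases m with
    | zero => simp [hf.not_gt]
    | succ m => simp [List.range_succ]

section Words

variable {A : Type*} [CommRing A] (e : Fin 6 → A)

lemma wordWt_map_range' (f : ℕ → ℕ) (N len i : ℕ) (h : i + len = N) :
    wordWt e ((List.range i).map f).reverse ((List.range' i len).map f) [] =
      ∏ j ∈ Finset.Ico i N, letterWt e ((List.range j).map f).reverse (f j)
        ((List.range' (j + 1) (N - (j + 1))).map f) := by
  induction len generalizing i with
  | zero => simp [← h, wordWt]
  | succ len ih =>
    have := ih (i + 1) (by omega)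
    rw [List.range_succ, List.map_append, List.reverse_append] at this
    rw [Finset.prod_eq_prod_Ico_succ_bot (by omega), ← this, List.range'_succ, List.map_cons,
      wordWt, List.append_nil, show N - (i + 1) = len by omega]
    rfl

lemma letterWt_pext {n : ℕ} (σ : Equiv.Perm (Fin n)) {i : ℕ} (hi : i ∈ Finset.Icc 1 n) :
    letterWt e ((List.range i).map (pext n σ)).reverse (pext n σ i)
        ((List.range' (i + 1) (n + 2 - (i + 1))).map (pext n σ)) =
      e 0 ^ (∑ j ∈ Finset.Icc 1 n, if i < j ∧ j ≤ n - 1 ∧ pext n σ j < pext n σ i ∧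
          pext n σ i < pext n σ (j + 1) then 1 else 0) *
        e 1 ^ (∑ j ∈ Finset.Icc 1 n, if 2 ≤ j ∧ j < i ∧ pext n σ j < pext n σ i ∧
          pext n σ i < pext n σ (j - 1) then 1 else 0) *
        e 2 ^ (if pext n σ i < pext n σ (i - 1) then 1 else 0) *
        e 3 ^ (if pext n σ (i - 1) < pext n σ i ∧ pext n σ i < pext n σ (i + 1) then 1 else 0) *
        e 4 ^ (if pext n σ (i + 1) < pext n σ i ∧ pext n σ i < pext n σ (i - 1) then 1 else 0) *
        e 5 ^ (if pext n σ i < pext n σ (i - 1) ∧ pext n σ i < pext n σ (i + 1)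
          then 1 else 0) := by
  have hpos := (Finset.mem_Icc.1 (pext_mem_Icc σ hi)).1
  have h0 : pext n σ 0 = 0 := pext_eq_zero σ (by omega)
  have hn1 : pext n σ (n + 1) = 0 := pext_eq_zero σ (by omega)
  have hn2 : pext n σ (n + 2) = 0 := pext_eq_zero σ (by omega)
  have hprev : pext n σ i ≠ pext n σ (i - 1) :=
    pext_ne_succ σ hi (by have := Finset.mem_Icc.1 hi; omega)
  have hnext : pext n σ i ≠ pext n σ (i + 1) := pext_ne_succ σ hi (by omega)
  obtain ⟨h1, h2⟩ := Finset.mem_Icc.1 hi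
  have hA : ((List.range i).map (pext n σ)).reverse.headD 0 = pext n σ (i - 1) := by
    obtain ⟨i, rfl⟩ := Nat.exists_eq_add_of_le' h1
    simp [List.range_succ]
  have hB : ((List.range' (i + 1) (n + 2 - (i + 1))).map (pext n σ)).headD 0 =
      pext n σ (i + 1) := by
    rw [show n + 2 - (i + 1) = (n - i) + 1 by omega, List.range'_succ]
    simp
  rw [letterWt, if_neg (by omega), hA, hB, ascCount_map_range' _ _
    (by rw [show i + 1 + (n + 2 - (i + 1)) = n + 2 by omega, hn2]; omega),
    ascCount_reverse_map_range (by omega), ← Finset.card_filter, ← Finset.card_filter]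
  have hres : ((Finset.Ico (i + 1) (i + 1 + (n + 2 - (i + 1)))).filter fun j =>
      pext n σ j < pext n σ i ∧ pext n σ i < pext n σ (j + 1)) =
      (Finset.Icc 1 n).filter fun j => i < j ∧ j ≤ n - 1 ∧ pext n σ j < pext n σ i ∧
          pext n σ i < pext n σ (j + 1) := by
    ext j
    simp only [Finset.mem_filter, Finset.mem_Ico, Finset.mem_Icc]
    constructor
    · rintro ⟨hj, h, h'⟩
      have : j + 1 ≤ n := by
        by_contra hc
        rw [pext_eq_zero σ (i := j + 1) (by omega)] at h'
        omega
      exact ⟨by omega, by omega, by omega, h, h'⟩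
    · rintro ⟨hj, hij, hjn, h, h'⟩
      exact ⟨by omega, h, h'⟩
  have hles : ((Finset.range i).filter fun j =>
      pext n σ j < pext n σ i ∧ pext n σ i < pext n σ (j - 1)) =
      (Finset.Icc 1 n).filter fun j => 2 ≤ j ∧ j < i ∧ pext n σ j < pext n σ i ∧
          pext n σ i < pext n σ (j - 1) := by
    ext j
    simp only [Finset.mem_filter, Finset.mem_range, Finset.mem_Icc]
    constructor
    · rintro ⟨hj, h, h'⟩
      have : 2 ≤ j := by
        by_contra hc
        rw [show j - 1 = 0 by omega, h0] at h'
        omega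
      exact ⟨by omega, by omega, by omega, h, h'⟩
    · rintro ⟨hj, -, hij, h, h'⟩
      exact ⟨hij, h, h'⟩
  rw [hres, hles]
  rcases lt_or_gt_of_ne hprev with h3 | h3 <;> rcases lt_or_gt_of_ne hnext with h4 | h4 <;>
    simp [h3, h4, h3.not_gt, h4.not_gt, mul_assoc]

lemma sum_ite_pext_lt (n : ℕ) (σ : Equiv.Perm (Fin n)) :
    (∑ i ∈ Finset.Icc 1 n, if pext n σ i < pext n σ (i - 1) then 1 else 0) = desStat n σ := by
  cases n with
  | zero => simp [desStat]
  | succ n =>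
    have h : Finset.Icc 1 (n + 1) = Finset.Ico 1 (n + 2) := rfl
    have h' : Finset.Icc 1 n = Finset.Ico 1 (n + 1) := rfl
    rw [desStat, Finset.card_filter, Nat.add_sub_cancel, h, h',
      Finset.sum_eq_sum_Ico_succ_bot (by omega), ← Finset.sum_Ico_add' _ 1 (n + 1) 1,
      if_neg (by simp [pext]), zero_add]
    rfl

lemma wordWt_permWord (n : ℕ) (σ : Equiv.Perm (Fin n)) :
    wordWt e [] (blockWord [permWord n σ]) [] =
      e 0 ^ resStat n σ * e 1 ^ lesStat n σ * e 2 ^ desStat n σ * e 3 ^ daStar n σ *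
        e 4 ^ ddStar n σ * e 5 ^ valleyStar n σ := by
  have h : blockWord [permWord n σ] = (List.range' 0 (n + 2)).map (pext n σ) := by
    rw [List.range'_1_concat, List.range'_succ, List.map_append, List.map_cons,
      pext_eq_zero σ (by omega : ¬(1 ≤ 0 ∧ 0 ≤ n))]
    simp [blockWord, sepBefore, permWord, pext_eq_zero σ (by omega : ¬(1 ≤ n + 1 ∧ n + 1 ≤ n))]
  have key := wordWt_map_range' e (pext n σ) (n + 2) (n + 2) 0 (by omega)
  rw [List.range_zero, List.map_nil, List.reverse_nil, ← h] at key
  rw [key, ← Finset.prod_subset (s₁ := Finset.Icc 1 n)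
    (by intro j; simp only [Finset.mem_Icc, Finset.mem_Ico]; omega)
    (fun j _ hj => by rw [letterWt, if_pos (pext_eq_zero σ (by simpa using hj))]),
    Finset.prod_congr rfl fun i hi => letterWt_pext e σ hi]
  simp only [Finset.prod_mul_distrib, Finset.prod_pow_eq_pow_sum, sum_ite_pext_lt]
  simp only [resStat, lesStat, daStar, ddStar, valleyStar, pairs, Finset.card_filter,
    Finset.sum_product]
  rw [Finset.sum_comm (s := Finset.Icc 1 n) (t := Finset.Icc 1 n)
    (f := fun i j => if 2 ≤ i ∧ i < j ∧ pext n σ i < pext n σ j ∧ pext n σ j < pext n σ (i - 1)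
      then 1 else 0)]

lemma sum_perm_eq_configSum {n : ℕ} (hn : 1 ≤ n) :
    ∑ σ : Equiv.Perm (Fin n), e 0 ^ resStat n σ * e 1 ^ lesStat n σ * e 2 ^ desStat n σ *
      e 3 ^ daStar n σ * e 4 ^ ddStar n σ * e 5 ^ valleyStar n σ =
      configSum e (Finset.Icc 1 n) 1 := by
  rw [configSum]
  refine Finset.sum_bij (fun σ _ => [permWord n σ]) (fun σ _ => ?_) (fun σ _ τ _ h => ?_)
    (fun c hc => ?_) fun σ _ => (wordWt_permWord e n σ).symm
  · refine mem_blockConfigs.2 ⟨?_, by simpa using coe_permWord n σ, rfl⟩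
    simp [permWord, Nat.one_le_iff_ne_zero.1 hn]
  · exact permWord_injective n (List.singleton_injective h)
  · obtain ⟨-, h, h1⟩ := mem_blockConfigs.1 hc
    obtain ⟨w, rfl⟩ := List.length_eq_one_iff.1 h1
    obtain ⟨σ, rfl⟩ := exists_permWord_eq (w := w) (by simpa using h)
    exact ⟨σ, Finset.mem_univ _, rfl⟩

end Words

open MvPolynomial in
theorem statement18 (n : ℕ) (hn : 1 ≤ n) :
    (∑ σ : Equiv.Perm (Fin n),
        (X 0 : MvPolynomial (Fin 6) ℤ) ^ resStat n σ * X 1 ^ lesStat n σ *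
          X 2 ^ desStat n σ * X 3 ^ daStar n σ * X 4 ^ ddStar n σ *
          X 5 ^ valleyStar n σ) =
      ∑ γ ∈ motzkin (n - 1),
        (X 2 * X 5) ^ neCount (n - 1) γ * (X 3 + X 2 * X 4) ^ eCount (n - 1) γ *
          ∏ i : Fin (n - 1),
            pqInt (X 0 : MvPolynomial (Fin 6) ℤ) (X 1)
              ((hgt (n - 1) γ (i : ℕ)).toNat + 1) := by
  rw [sum_perm_eq_configSum (X : Fin 6 → MvPolynomial (Fin 6) ℤ) hn,
    sum_motzkin_eq_pathSum (X : Fin 6 → MvPolynomial (Fin 6) ℤ)]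
  exact configSum_eq_pathSum X (Finset.Icc 1 n) (fun x hx => (Finset.mem_Icc.1 hx).1) (n - 1)
    (by rw [Nat.card_Icc]; omega) 0

end SZpaper
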